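/- An 8×8 skew-Hermitian complex matrix M satisfies [M, H_x] = 0, [M, H_y] = 0 and [M, H_zz] = 0 if and only if M lies in the real linear span of the five skew-Hermitian matrices E₁, E₂, E₃, E₄, E₅. -/

import Mathlib

open Matrix Complex

noncomputable section

/-- Index type for three qubits: `(ℂ²)^{⊗3} ≅ ℂ⁸` with basis `|jkl⟩`. -/
abbrev Q3 := Fin 2 × Fin 2 × Fin 2

/-- Pauli matrix σx. -/
def sx : Matrix (Fin 2) (Fin 2) ℂ := !![0, 1; 1, 0]
/-- Pauli matrix σy. -/
def sy : Matrix (Fin 2) (Fin 2) ℂ := !![0, I; -I, 0]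
/-- Pauli matrix σz. -/
def sz : Matrix (Fin 2) (Fin 2) ℂ := !![1, 0; 0, -1]

/-- Tensor (Kronecker) product of three 2×2 matrices, as an 8×8 matrix. -/
def tens3 (A B C : Matrix (Fin 2) (Fin 2) ℂ) : Matrix Q3 Q3 ℂ :=
  fun p q => A p.1 q.1 * B p.2.1 q.2.1 * C p.2.2 q.2.2

/-- Computational basis vector `|jkl⟩`. -/
def ket (j k l : Fin 2) : Q3 → ℂ := fun p => if p = (j, k, l) then 1 else 0

/-- φ₀ = |000⟩. -/
def phi0 : Q3 → ℂ := ket 0 0 0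
/-- φ₁ = |100⟩+|010⟩+|001⟩. -/
def phi1 : Q3 → ℂ := ket 1 0 0 + ket 0 1 0 + ket 0 0 1
/-- φ₂ = |110⟩+|011⟩+|101⟩. -/
def phi2 : Q3 → ℂ := ket 1 1 0 + ket 0 1 1 + ket 1 0 1
/-- φ₃ = |111⟩. -/
def phi3 : Q3 → ℂ := ket 1 1 1

/-- H_w = σw⊗1⊗1 + 1⊗σw⊗1 + 1⊗1⊗σw. -/
def Hx : Matrix Q3 Q3 ℂ := tens3 sx 1 1 + tens3 1 sx 1 + tens3 1 1 sx
def Hy : Matrix Q3 Q3 ℂ := tens3 sy 1 1 + tens3 1 sy 1 + tens3 1 1 sy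
/-- H_zz = σz⊗σz⊗1 + 1⊗σz⊗σz + σz⊗1⊗σz. -/
def Hzz : Matrix Q3 Q3 ℂ := tens3 sz sz 1 + tens3 1 sz sz + tens3 sz 1 sz

/-- E₁, defined by iE₁ = 1⊗1⊗1. -/
def E1 : Matrix Q3 Q3 ℂ := (-I) • (1 : Matrix Q3 Q3 ℂ)
/-- E₂, defined by iE₂ = σx⊗1⊗σx + σy⊗1⊗σy + σz⊗1⊗σz. -/
def E2 : Matrix Q3 Q3 ℂ := (-I) • (tens3 sx 1 sx + tens3 sy 1 sy + tens3 sz 1 sz)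
/-- E₃, defined by iE₃ = σx⊗σx⊗1 + σy⊗σy⊗1 + σz⊗σz⊗1. -/
def E3 : Matrix Q3 Q3 ℂ := (-I) • (tens3 sx sx 1 + tens3 sy sy 1 + tens3 sz sz 1)
/-- E₄, defined by iE₄ = 1⊗σx⊗σx + 1⊗σy⊗σy + 1⊗σz⊗σz. -/
def E4 : Matrix Q3 Q3 ℂ := (-I) • (tens3 1 sx sx + tens3 1 sy sy + tens3 1 sz sz)
/-- E₅, defined by iE₅ = σx⊗(σy⊗σz − σz⊗σy) + σy⊗(σz⊗σx − σx⊗σz) + σz⊗(σx⊗σy − σy⊗σx). -/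
def E5 : Matrix Q3 Q3 ℂ := (-I) • (tens3 sx sy sz - tens3 sx sz sy + tens3 sy sz sx
  - tens3 sy sx sz + tens3 sz sx sy - tens3 sz sy sx)

/-- The tensor product of matrices is multiplicative. -/
theorem tens3_mul (A B C A' B' C' : Matrix (Fin 2) (Fin 2) ℂ) :
    tens3 A B C * tens3 A' B' C' = tens3 (A * A') (B * B') (C * C') := by
  ext p q
  simp only [tens3, Matrix.mul_apply, Fintype.sum_prod_type, Fin.sum_univ_two]
  ring

theorem tens3_smul_left (c : ℂ) (A B C : Matrix (Fin 2) (Fin 2) ℂ) :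
    tens3 (c • A) B C = c • tens3 A B C := by
  ext p q
  simp only [tens3, Matrix.smul_apply, smul_eq_mul]
  ring

theorem tens3_smul_middle (c : ℂ) (A B C : Matrix (Fin 2) (Fin 2) ℂ) :
    tens3 A (c • B) C = c • tens3 A B C := by
  ext p q
  simp only [tens3, Matrix.smul_apply, smul_eq_mul]
  ring

theorem tens3_smul_right (c : ℂ) (A B C : Matrix (Fin 2) (Fin 2) ℂ) :
    tens3 A B (c • C) = c • tens3 A B C := by
  ext p q
  simp only [tens3, Matrix.smul_apply, smul_eq_mul]
  ring

theorem sx_mul_sx : sx * sx = 1 := by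
  ext i j; fin_cases i <;> fin_cases j <;> simp [sx]

theorem sy_mul_sy : sy * sy = 1 := by
  ext i j; fin_cases i <;> fin_cases j <;> simp [sy]

theorem sz_mul_sz : sz * sz = 1 := by
  ext i j; fin_cases i <;> fin_cases j <;> simp [sz]

theorem sx_mul_sy : sx * sy = (-I) • sz := by
  ext i j; fin_cases i <;> fin_cases j <;> simp [sx, sy, sz]

theorem sy_mul_sx : sy * sx = I • sz := by
  ext i j; fin_cases i <;> fin_cases j <;> simp [sx, sy, sz]

theorem sy_mul_sz : sy * sz = (-I) • sx := by
  ext i j; fin_cases i <;> fin_cases j <;> simp [sx, sy, sz]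

theorem sz_mul_sy : sz * sy = I • sx := by
  ext i j; fin_cases i <;> fin_cases j <;> simp [sx, sy, sz]

theorem sz_mul_sx : sz * sx = (-I) • sy := by
  ext i j; fin_cases i <;> fin_cases j <;> simp [sx, sy, sz]

theorem sx_mul_sz : sx * sz = I • sy := by
  ext i j; fin_cases i <;> fin_cases j <;> simp [sx, sy, sz]

set_option maxHeartbeats 2000000 in
theorem commute_of_mem_generators {E : Matrix Q3 Q3 ℂ}
    (hE : E ∈ ({E1, E2, E3, E4, E5} : Set (Matrix Q3 Q3 ℂ))) :
    E * Hx = Hx * E ∧ E * Hy = Hy * E ∧ E * Hzz = Hzz * E := by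
  rcases hE with rfl | rfl | rfl | rfl | rfl <;>
  refine ⟨?_, ?_, ?_⟩ <;>
  simp only [E1, E2, E3, E4, E5, Hx, Hy, Hzz, smul_mul_assoc, mul_smul_comm, add_mul, mul_add,
    sub_mul, mul_sub, tens3_mul, one_mul, mul_one, sx_mul_sx, sy_mul_sy, sz_mul_sz, sx_mul_sy,
    sy_mul_sx, sy_mul_sz, sz_mul_sy, sz_mul_sx, sx_mul_sz, tens3_smul_left, tens3_smul_middle,
    tens3_smul_right] <;>
  module

/-- Collective spin along `z`, up to sign, is the commutator of `Hx` and `Hy`. -/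
theorem commutator_Hx_Hy : Hx * Hy - Hy * Hx =
    (-(2 * I)) • (tens3 sz 1 1 + tens3 1 sz 1 + tens3 1 1 sz) := by
  simp only [Hx, Hy, add_mul, mul_add, tens3_mul, one_mul, mul_one, sx_mul_sy,
    sy_mul_sx, tens3_smul_left, tens3_smul_middle, tens3_smul_right]
  module

theorem tens3_sz_sum : tens3 sz 1 1 + tens3 1 sz 1 + tens3 1 1 sz =
    diagonal fun p : Q3 => (![1, -1] p.1 + ![1, -1] p.2.1 + ![1, -1] p.2.2 : ℂ) := by
  have h : sz = diagonal ![1, -1] := by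
    ext i j; fin_cases i <;> fin_cases j <;> simp [sz]
  ext ⟨i, j, k⟩ ⟨l, m, n⟩
  simp only [h, tens3, Matrix.add_apply, diagonal_apply, one_apply, Prod.mk.injEq]
  by_cases h1 : i = l <;> by_cases h2 : j = m <;> by_cases h3 : k = n <;> simp [h1, h2, h3]

theorem apply_eq_zero_of_commute {M : Matrix Q3 Q3 ℂ} (hx : M * Hx = Hx * M)
    (hy : M * Hy = Hy * M) (p q : Q3)
    (hpq : (![1, -1] p.1 + ![1, -1] p.2.1 + ![1, -1] p.2.2 : ℂ) ≠
      ![1, -1] q.1 + ![1, -1] q.2.1 + ![1, -1] q.2.2) : M p q = 0 := by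
  have h : M * (Hx * Hy - Hy * Hx) = (Hx * Hy - Hy * Hx) * M := by
    rw [mul_sub, sub_mul, ← mul_assoc, ← mul_assoc, hx, hy, mul_assoc, mul_assoc, hx, hy,
      mul_assoc, mul_assoc]
  rw [commutator_Hx_Hy, tens3_sz_sum, mul_smul_comm, smul_mul_assoc] at h
  have h2 := congrFun₂ (smul_right_injective _ (by simp : -(2 * I) ≠ 0) h) p q
  rw [mul_diagonal, diagonal_mul, mul_comm] at h2
  by_contra hne
  exact hpq (mul_right_cancel₀ hne h2).symm

theorem commute_of_mem_span {M : Matrix Q3 Q3 ℂ}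
    (hM : M ∈ Submodule.span ℝ ({E1, E2, E3, E4, E5} : Set (Matrix Q3 Q3 ℂ))) :
    M * Hx = Hx * M ∧ M * Hy = Hy * M ∧ M * Hzz = Hzz * M := by
  induction hM using Submodule.span_induction with
  | mem E hE => exact commute_of_mem_generators hE
  | zero => simp
  | add A B _ _ hA hB =>
    simp only [add_mul, mul_add, hA.1, hA.2.1, hA.2.2, hB.1, hB.2.1, hB.2.2, and_self]
  | smul c A _ hA =>
    simp only [smul_mul_assoc, mul_smul_comm, hA.1, hA.2.1, hA.2.2, and_self]

/-- A matrix commuting with `Hx` and `Hy` is determined by five linear functionals of its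
entries on the states of at most one excitation. -/
theorem eq_zero_of_commute {M : Matrix Q3 Q3 ℂ} (hx : M * Hx = Hx * M) (hy : M * Hy = Hy * M)
    (h0 : M (0, 0, 0) (0, 0, 0) = 0) (h12 : M (1, 0, 0) (0, 1, 0) = 0)
    (h21 : M (0, 1, 0) (1, 0, 0) = 0)
    (h13 : M (1, 0, 0) (0, 0, 1) + M (0, 0, 1) (1, 0, 0) = 0)
    (h23 : M (0, 1, 0) (0, 0, 1) + M (0, 0, 1) (0, 1, 0) = 0) : M = 0 := by
  have hl : M * (Hx + I • Hy) = (Hx + I • Hy) * M := by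
    rw [mul_add, add_mul, mul_smul_comm, smul_mul_assoc, hx, hy]
  have hu : M * (Hx - I • Hy) = (Hx - I • Hy) * M := by
    rw [mul_sub, sub_mul, mul_smul_comm, smul_mul_assoc, hx, hy]
  have l1 := congrFun₂ hl (1, 0, 0) (0, 0, 0)
  have l2 := congrFun₂ hl (0, 1, 0) (0, 0, 0)
  have l3 := congrFun₂ hl (0, 0, 1) (0, 0, 0)
  have u1 := congrFun₂ hu (0, 0, 0) (1, 0, 0)
  have u2 := congrFun₂ hu (0, 0, 0) (0, 1, 0)
  have u3 := congrFun₂ hu (0, 0, 0) (0, 0, 1)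
  have b11 := congrFun₂ hl (0, 1, 1) (1, 0, 0)
  have b12 := congrFun₂ hl (0, 1, 1) (0, 1, 0)
  have b13 := congrFun₂ hl (0, 1, 1) (0, 0, 1)
  have b21 := congrFun₂ hl (1, 0, 1) (1, 0, 0)
  have b22 := congrFun₂ hl (1, 0, 1) (0, 1, 0)
  have b23 := congrFun₂ hl (1, 0, 1) (0, 0, 1)
  have b31 := congrFun₂ hl (1, 1, 0) (1, 0, 0)
  have b32 := congrFun₂ hl (1, 1, 0) (0, 1, 0)
  have b33 := congrFun₂ hl (1, 1, 0) (0, 0, 1)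
  have d := congrFun₂ hl (1, 1, 1) (0, 1, 1)
  simp [Matrix.mul_apply, Fintype.sum_prod_type, Fin.sum_univ_two, Hx, Hy, tens3, sx, sy,
    ← mul_assoc] at l1 l2 l3 u1 u2 u3 b11 b12 b13 b21 b22 b23 b31 b32 b33 d
  have z := apply_eq_zero_of_commute hx hy
  ext ⟨i, j, k⟩ ⟨l, m, n⟩
  fin_cases i <;> fin_cases j <;> fin_cases k <;> fin_cases l <;> fin_cases m <;> fin_cases n <;>
  first
  | (refine z _ _ ?_; norm_num; done)
  | (simp only [Fin.zero_eta, Fin.mk_one, Matrix.zero_apply]; grind)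

theorem mem_span_of_commute {M : Matrix Q3 Q3 ℂ} (hM : Mᴴ = -M) (hx : M * Hx = Hx * M)
    (hy : M * Hy = Hy * M) :
    M ∈ Submodule.span ℝ ({E1, E2, E3, E4, E5} : Set (Matrix Q3 Q3 ℂ)) := by
  let c2 : ℝ := -(M (1, 0, 0) (0, 0, 1)).im / 2
  let c3 : ℝ := -(M (1, 0, 0) (0, 1, 0)).im / 2
  let c4 : ℝ := -(M (0, 1, 0) (0, 0, 1)).im / 2
  let c5 : ℝ := (M (1, 0, 0) (0, 1, 0)).re / 2
  let c1 : ℝ := -(M (0, 0, 0) (0, 0, 0)).im - (c2 + c3 + c4)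
  have hS : c1 • E1 + c2 • E2 + c3 • E3 + c4 • E4 + c5 • E5 ∈
      Submodule.span ℝ ({E1, E2, E3, E4, E5} : Set (Matrix Q3 Q3 ℂ)) := by
    refine add_mem (add_mem (add_mem (add_mem ?_ ?_) ?_) ?_) ?_ <;>
    exact Submodule.smul_mem _ _ (Submodule.subset_span (by simp))
  obtain ⟨sx', sy', -⟩ := commute_of_mem_span hS
  have star_apply (p q : Q3) : star (M q p) = -M p q := congrFun₂ hM p q
  have a0 := star_apply (0, 0, 0) (0, 0, 0)
  have a12 := star_apply (0, 1, 0) (1, 0, 0)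
  have a13 := star_apply (0, 0, 1) (1, 0, 0)
  have a23 := star_apply (0, 0, 1) (0, 1, 0)
  simp only [Complex.ext_iff, star_def, conj_re, conj_im, neg_re, neg_im] at a0 a12 a13 a23
  have key : M - (c1 • E1 + c2 • E2 + c3 • E3 + c4 • E4 + c5 • E5) = 0 := by
    apply eq_zero_of_commute
    · rw [sub_mul, mul_sub, hx, sx']
    · rw [sub_mul, mul_sub, hy, sy']
    all_goals
      apply Complex.ext <;>
      simp [E1, E2, E3, E4, E5, tens3, sx, sy, sz, c1, c2, c3, c4, c5] <;>
      linarith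
  rw [sub_eq_zero.mp key]
  exact hS

/-- a skew-Hermitian 8×8 matrix M commutes with H_x, H_y and H_zz
if and only if M lies in the real linear span of E₁,…,E₅. -/
theorem statement2 (M : Matrix Q3 Q3 ℂ) (hM : Mᴴ = -M) :
    (M * Hx = Hx * M ∧ M * Hy = Hy * M ∧ M * Hzz = Hzz * M) ↔
      M ∈ Submodule.span ℝ ({E1, E2, E3, E4, E5} : Set (Matrix Q3 Q3 ℂ)) := by
  exact ⟨fun h => mem_span_of_commute hM h.1 h.2.1, commute_of_mem_span⟩
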